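/- Consider the location target with scale τ > 0 and negative log-density ψ satisfying Assumption 2, and set ρ(t) = exp(−ψ(t)). Let N ≥ 1 be an integer and λ > 0. Then for every integer n with 1 ≤ n ≤ 2N and every x ∈ ℝ: (i) ∫_ℝ ρ^{(n)}(t) dt = 0 (the n-th derivative of ρ is integrable with zero integral); and (ii) ∫_{{y ∈ ℝ : (y−x)/τ ∈ A^c(ψ,2N,λ)}} |∂_x^{n} v(y;x)| dy ≤ (n!·λ^n·e^n/τ^n)·Err(ψ, 2N, λ). -/

import Mathlib

open MeasureTheory Real Filter

/-- The Gaussian source density `u(x;θ)` with standard deviation `σ`. -/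
noncomputable def srcDensity (σ θ x : ℝ) : ℝ :=
  (1 / (Real.sqrt (2 * Real.pi) * σ)) * Real.exp (-(x - θ)^2 / (2 * σ^2))

/-- The location target density `v(y;θ) = (1/τ)·exp(−ψ((y−θ)/τ))`. -/
noncomputable def locDensity (ψ : ℝ → ℝ) (τ y θ : ℝ) : ℝ :=
  (1/τ) * Real.exp (-ψ ((y - θ)/τ))

/-- The weighted derivative sum `Σ_{j=1}^{n} |ψ^{(j)}(t)|/(λ^j·j!)`. -/
noncomputable def derivSum (ψ : ℝ → ℝ) (n : ℕ) (lam t : ℝ) : ℝ :=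
  ∑ j ∈ Finset.Icc 1 n, |iteratedDeriv j ψ t| / (lam^j * (Nat.factorial j : ℝ))

/-- The set `A(ψ,n,λ) = {t : Σ_{j=1}^{n} |ψ^{(j)}(t)|/(λ^j·j!) ≤ 1}`. -/
def ASet (ψ : ℝ → ℝ) (n : ℕ) (lam : ℝ) : Set ℝ :=
  {t : ℝ | derivSum ψ n lam t ≤ 1}

/-- `Err(ψ,n,λ)`. -/
noncomputable def ErrPsi (ψ : ℝ → ℝ) (n : ℕ) (lam : ℝ) : ℝ :=
  (∫ t in (ASet ψ n lam)ᶜ, Real.exp (-ψ t)) +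
    ⨆ k ∈ Finset.Icc 1 n,
      ∫ t in (ASet ψ n lam)ᶜ, Real.exp (-ψ t) * (derivSum ψ n lam t)^k

/-- `M(ψ,n,λ)`. -/
noncomputable def MPsi (ψ : ℝ → ℝ) (n : ℕ) (lam : ℝ) : ℝ :=
  ⨆ k ∈ Finset.Icc 1 n, ⨆ t : ℝ,
    Real.exp (-ψ t + ψ (t/2)) * (1 + (derivSum ψ n lam t)^k)

/-- Assumption 2 on the negative log-density `ψ` with constants `(Cψ, C̃ψ)`. -/
structure Assumption2 (ψ : ℝ → ℝ) (Cψ : ℕ) (Ct : ℝ) : Prop where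
  Ct_pos : 0 < Ct
  norm_one : ∫ t : ℝ, Real.exp (-ψ t) = 1
  sq_int : Integrable (fun t : ℝ => Real.exp (-(2 * ψ t)))
  smooth : ContDiff ℝ (⊤ : ℕ∞) ψ
  moment_int : ∀ n : ℕ, 1 ≤ n → ∀ k : ℕ, 1 ≤ k → k ≤ n →
    Integrable (fun t : ℝ => Real.exp (-ψ t) * (derivSum ψ n Ct t)^k)
  moment_le : ∀ n : ℕ, 1 ≤ n → ∀ k : ℕ, 1 ≤ k → k ≤ n →
    ∫ t : ℝ, Real.exp (-ψ t) * (derivSum ψ n Ct t)^k ≤ (Nat.factorial (Cψ * n) : ℝ)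

/-- `C̄ψ = 16π²·(2e)^{4(1+Cψ)}·e^{4(1+Cψ)²}`. -/
noncomputable def CbarPsi (Cψ : ℕ) : ℝ :=
  16 * Real.pi^2 * (2 * Real.exp 1)^(4*(1+Cψ)) * (Real.exp 1)^(4*(1+Cψ)^2)

/-- The truncated signed kernel `S*_N(y|x)`. -/
noncomputable def signedKernel (σ : ℝ) (v : ℝ → ℝ → ℝ) (N : ℕ) (y x : ℝ) : ℝ :=
  ∑ k ∈ Finset.range (N + 1),
    ((-1 : ℝ)^k * σ^(2*k) / ((2:ℝ)^k * (Nat.factorial k : ℝ))) *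
      iteratedDeriv (2*k) (fun θ => v y θ) x

/-- `p(x) = ∫ max(S*_N(y|x), 0) dy`. -/
noncomputable def pFun (σ : ℝ) (v : ℝ → ℝ → ℝ) (N : ℕ) (x : ℝ) : ℝ :=
  ∫ y : ℝ, max (signedKernel σ v N y x) 0

/-- `q(x) = −∫ min(S*_N(y|x), 0) dy`. -/
noncomputable def qFun (σ : ℝ) (v : ℝ → ℝ → ℝ) (N : ℕ) (x : ℝ) : ℝ :=
  - ∫ y : ℝ, min (signedKernel σ v N y x) 0

/-- The Markov kernel `T*_N(y|x) = max(S*_N(y|x), 0)/p(x)`. -/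
noncomputable def markovKernel (σ : ℝ) (v : ℝ → ℝ → ℝ) (N : ℕ) (y x : ℝ) : ℝ :=
  max (signedKernel σ v N y x) 0 / pFun σ v N x

lemma derivSum_nonneg (ψ : ℝ → ℝ) (n : ℕ) {lam : ℝ} (hlam : 0 < lam) (t : ℝ) :
    0 ≤ derivSum ψ n lam t :=
  Finset.sum_nonneg fun _ _ => by positivity

lemma continuous_derivSum {ψ : ℝ → ℝ} (hψ : ContDiff ℝ (⊤ : ℕ∞) ψ) (n : ℕ) (lam : ℝ) :
    Continuous (derivSum ψ n lam) := by
  refine continuous_finsetSum _ fun j _ => ?_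
  exact ((hψ.continuous_iteratedDeriv j (by exact_mod_cast le_top)).abs).div_const _

lemma measurableSet_ASet {ψ : ℝ → ℝ} (hψ : ContDiff ℝ (⊤ : ℕ∞) ψ) (n : ℕ) (lam : ℝ) :
    MeasurableSet (ASet ψ n lam) :=
  (isClosed_le (continuous_derivSum hψ n lam) continuous_const).measurableSet

/-- Changing the weight in `derivSum` costs at most a multiplicative constant. -/
lemma derivSum_le_mul_derivSum (ψ : ℝ → ℝ) (n : ℕ) {lam mu : ℝ} (hlam : 0 < lam)
    (hmu : 0 < mu) (t : ℝ) :
    derivSum ψ n lam t ≤ (max 1 (mu / lam)) ^ n * derivSum ψ n mu t := by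
  unfold derivSum
  rw [Finset.mul_sum]
  refine Finset.sum_le_sum fun j hj => ?_
  have hj' := (Finset.mem_Icc.1 hj).2
  have hpow : (mu / lam) ^ j ≤ (max 1 (mu / lam)) ^ n :=
    (pow_le_pow_left₀ (by positivity) (le_max_right _ _) j).trans
      (pow_le_pow_right₀ (le_max_left _ _) hj')
  calc |iteratedDeriv j ψ t| / (lam ^ j * (Nat.factorial j : ℝ))
      = (mu / lam) ^ j * (|iteratedDeriv j ψ t| / (mu ^ j * (Nat.factorial j : ℝ))) := by
        rw [div_pow]; field_simp
    _ ≤ _ := by gcongr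

lemma contDiff_exp_neg {ψ : ℝ → ℝ} (hψ : ContDiff ℝ (⊤ : ℕ∞) ψ) :
    ContDiff ℝ (⊤ : ℕ∞) (fun t => Real.exp (-ψ t)) :=
  hψ.neg.exp

lemma iteratedDeriv_succ_exp_neg {ψ : ℝ → ℝ} (hψ : ContDiff ℝ (⊤ : ℕ∞) ψ) (n : ℕ) (t : ℝ) :
    iteratedDeriv (n + 1) (fun s => Real.exp (-ψ s)) t =
      -∑ i ∈ Finset.range (n + 1), n.choose i * iteratedDeriv (i + 1) ψ t *
        iteratedDeriv (n - i) (fun s => Real.exp (-ψ s)) t := by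
  have hd : deriv (fun s => Real.exp (-ψ s)) =
      -(deriv ψ * fun s => Real.exp (-ψ s)) := by
    ext s
    have h := ((hψ.differentiable (by simp) s).hasDerivAt.neg.exp).deriv
    simp only [Pi.neg_apply] at h
    refine Eq.trans h ?_
    simp only [Pi.neg_apply, Pi.mul_apply]
    ring
  have hψ' : ContDiff ℝ (⊤ : ℕ∞) (deriv ψ) := (contDiff_infty_iff_deriv.1 hψ).2
  have hn : ((n : ℕ∞) : WithTop ℕ∞) ≤ ((⊤ : ℕ∞) : WithTop ℕ∞) := by exact_mod_cast le_top
  rw [iteratedDeriv_succ', hd, iteratedDeriv_neg,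
    iteratedDeriv_mul (hψ'.of_le hn).contDiffAt ((contDiff_exp_neg hψ).of_le hn).contDiffAt]
  simp only [iteratedDeriv_succ']

/-- Pointwise bound on the derivatives of `exp (-ψ)` in terms of the weighted derivative sum. -/
lemma abs_iteratedDeriv_exp_neg_le {ψ : ℝ → ℝ} (hψ : ContDiff ℝ (⊤ : ℕ∞) ψ) {lam : ℝ}
    (hlam : 0 < lam) (M : ℕ) (t : ℝ) (n : ℕ) (hn : n ≤ M) :
    |iteratedDeriv n (fun s => Real.exp (-ψ s)) t| ≤
      (Nat.factorial n : ℝ) * lam ^ n * (max 1 (derivSum ψ M lam t)) ^ n * Real.exp (-ψ t) := by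
  induction n using Nat.strong_induction_on with
  | _ n ih =>
  rcases n with _ | n
  · simp
  set m := max 1 (derivSum ψ M lam t) with hm
  have hm1 : 1 ≤ m := le_max_left _ _
  have hterm : ∀ i ∈ Finset.range (n + 1),
      |n.choose i * iteratedDeriv (i + 1) ψ t *
        iteratedDeriv (n - i) (fun s => Real.exp (-ψ s)) t| ≤
      (Nat.factorial (n + 1) : ℝ) * lam ^ (n + 1) * m ^ n * Real.exp (-ψ t) *
        (|iteratedDeriv (i + 1) ψ t| / (lam ^ (i + 1) * (Nat.factorial (i + 1) : ℝ))) := by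
    intro i hi
    have hi' : i ≤ n := Nat.lt_succ_iff.1 (Finset.mem_range.1 hi)
    have hrec := ih (n - i) (by omega) (by omega)
    have hpow : m ^ (n - i) ≤ m ^ n := pow_le_pow_right₀ hm1 (Nat.sub_le _ _)
    have hchoose : (n.choose i : ℝ) * (Nat.factorial (n - i) : ℝ) * (Nat.factorial i : ℝ) =
        (Nat.factorial n : ℝ) := by
      have := Nat.choose_mul_factorial_mul_factorial hi'
      rw [← this]; push_cast; ring
    have hlam' : lam ^ (n + 1) = lam ^ (n - i) * lam ^ (i + 1) := by
      rw [← pow_add]; congr 1; omega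
    have hin : ((i : ℝ) + 1) ≤ (n : ℝ) + 1 := by
      have : (i : ℝ) ≤ n := by exact_mod_cast hi'
      linarith
    rw [abs_mul, abs_mul, Nat.abs_cast]
    calc (n.choose i : ℝ) * |iteratedDeriv (i + 1) ψ t| *
          |iteratedDeriv (n - i) (fun s => Real.exp (-ψ s)) t|
        ≤ (n.choose i : ℝ) * |iteratedDeriv (i + 1) ψ t| *
          ((Nat.factorial (n - i) : ℝ) * lam ^ (n - i) * m ^ n * Real.exp (-ψ t)) := by
          gcongr
          exact hrec.trans (by gcongr)
      _ = ((i : ℝ) + 1) * ((Nat.factorial n : ℝ) * lam ^ (n + 1) * m ^ n * Real.exp (-ψ t) *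
          (|iteratedDeriv (i + 1) ψ t| / (lam ^ (i + 1) * (Nat.factorial (i + 1) : ℝ)))) := by
          rw [← hchoose, hlam', Nat.factorial_succ i]
          push_cast
          field_simp
      _ ≤ ((n : ℝ) + 1) * ((Nat.factorial n : ℝ) * lam ^ (n + 1) * m ^ n * Real.exp (-ψ t) *
          (|iteratedDeriv (i + 1) ψ t| / (lam ^ (i + 1) * (Nat.factorial (i + 1) : ℝ)))) := by
          gcongr
      _ = _ := by
          rw [Nat.factorial_succ n]; push_cast; ring
  have hsum : ∑ i ∈ Finset.range (n + 1),
      |iteratedDeriv (i + 1) ψ t| / (lam ^ (i + 1) * (Nat.factorial (i + 1) : ℝ)) ≤ m := by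
    refine le_trans ?_ (le_max_right _ _)
    unfold derivSum
    rw [Finset.range_eq_Ico, Finset.sum_Ico_add'
      (fun j => |iteratedDeriv j ψ t| / (lam ^ j * (Nat.factorial j : ℝ))) 0 (n + 1) 1]
    refine Finset.sum_le_sum_of_subset_of_nonneg ?_ fun _ _ _ => by positivity
    intro j hj
    rw [Finset.mem_Ico] at hj
    rw [Finset.mem_Icc]
    omega
  rw [iteratedDeriv_succ_exp_neg hψ, abs_neg]
  refine (Finset.abs_sum_le_sum_abs _ _).trans ((Finset.sum_le_sum hterm).trans ?_)
  rw [← Finset.mul_sum]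
  calc _ ≤ (Nat.factorial (n + 1) : ℝ) * lam ^ (n + 1) * m ^ n * Real.exp (-ψ t) * m := by gcongr
    _ = _ := by ring

namespace Assumption2

variable {ψ : ℝ → ℝ} {Cψ : ℕ} {Ct : ℝ}

lemma integrable_exp_neg (hψ : Assumption2 ψ Cψ Ct) :
    Integrable (fun t => Real.exp (-ψ t)) := by
  by_contra h
  have := hψ.norm_one
  rw [integral_undef h] at this
  exact zero_ne_one this

/-- The moment integrability of `Assumption2` does not depend on the weight. -/
lemma integrable_exp_neg_mul_derivSum_pow (hψ : Assumption2 ψ Cψ Ct) {lam : ℝ} (hlam : 0 < lam)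
    {n k : ℕ} (hk : 1 ≤ k) (hkn : k ≤ n) :
    Integrable (fun t => Real.exp (-ψ t) * derivSum ψ n lam t ^ k) := by
  have hcont : Continuous fun t => Real.exp (-ψ t) * derivSum ψ n lam t ^ k :=
    (contDiff_exp_neg hψ.smooth).continuous.mul ((continuous_derivSum hψ.smooth n lam).pow k)
  refine ((hψ.moment_int n (hk.trans hkn) k hk hkn).const_mul
    (((max 1 (Ct / lam)) ^ n) ^ k)).mono' hcont.aestronglyMeasurable (ae_of_all _ fun t => ?_)
  have h0 := derivSum_nonneg ψ n hlam t
  rw [Real.norm_of_nonneg (by positivity)]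
  calc Real.exp (-ψ t) * derivSum ψ n lam t ^ k
      ≤ Real.exp (-ψ t) * ((max 1 (Ct / lam)) ^ n * derivSum ψ n Ct t) ^ k := by
        gcongr
        exact derivSum_le_mul_derivSum ψ n hlam hψ.Ct_pos t
    _ = _ := by rw [mul_pow]; ring

lemma integrable_iteratedDeriv_exp_neg (hψ : Assumption2 ψ Cψ Ct) (n : ℕ) :
    Integrable (iteratedDeriv n (fun t => Real.exp (-ψ t))) := by
  rcases Nat.eq_zero_or_pos n with rfl | hn
  · simpa using hψ.integrable_exp_neg
  have hcont : Continuous (iteratedDeriv n (fun t => Real.exp (-ψ t))) :=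
    (contDiff_exp_neg hψ.smooth).continuous_iteratedDeriv n (by exact_mod_cast le_top)
  refine ((hψ.integrable_exp_neg.add (hψ.moment_int n hn n hn le_rfl)).const_mul
    ((Nat.factorial n : ℝ) * Ct ^ n)).mono' hcont.aestronglyMeasurable (ae_of_all _ fun t => ?_)
  have hCt := hψ.Ct_pos
  have h0 := derivSum_nonneg ψ n hCt t
  have hmax : (max 1 (derivSum ψ n Ct t)) ^ n ≤ 1 + derivSum ψ n Ct t ^ n := by
    rcases max_cases 1 (derivSum ψ n Ct t) with ⟨h, _⟩ | ⟨h, _⟩ <;> rw [h]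
    · simpa using pow_nonneg h0 n
    · linarith
  refine (abs_iteratedDeriv_exp_neg_le hψ.smooth hCt n t n le_rfl).trans ?_
  calc _ ≤ (Nat.factorial n : ℝ) * Ct ^ n * (1 + derivSum ψ n Ct t ^ n) * Real.exp (-ψ t) := by
        gcongr
    _ = _ := by simp only [Pi.add_apply]; ring

lemma integral_iteratedDeriv_exp_neg (hψ : Assumption2 ψ Cψ Ct) {n : ℕ} (hn : 1 ≤ n) :
    ∫ t, iteratedDeriv n (fun s => Real.exp (-ψ s)) t = 0 := by
  obtain ⟨n, rfl⟩ := Nat.exists_eq_add_of_le' hn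
  refine integral_eq_zero_of_hasDerivAt_of_integrable
    (f := iteratedDeriv n (fun s => Real.exp (-ψ s))) (fun t => ?_)
    (hψ.integrable_iteratedDeriv_exp_neg _) (hψ.integrable_iteratedDeriv_exp_neg _)
  rw [iteratedDeriv_succ]
  exact ((contDiff_exp_neg hψ.smooth).differentiable_iteratedDeriv n
    (by exact_mod_cast WithTop.coe_lt_top _) t).hasDerivAt

/-- Over the complement of `ASet`, each absolute derivative integrates to at most a constant
multiple of `ErrPsi`. -/
lemma setIntegral_abs_iteratedDeriv_exp_neg_le (hψ : Assumption2 ψ Cψ Ct) {lam : ℝ}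
    (hlam : 0 < lam) {n M : ℕ} (hn : 1 ≤ n) (hnM : n ≤ M) :
    ∫ t in (ASet ψ M lam)ᶜ, |iteratedDeriv n (fun s => Real.exp (-ψ s)) t| ≤
      (Nat.factorial n : ℝ) * lam ^ n * ErrPsi ψ M lam := by
  have hmeas := (measurableSet_ASet hψ.smooth M lam).compl
  have hpow := hψ.integrable_exp_neg_mul_derivSum_pow hlam hn hnM
  have hle_err : ∫ t in (ASet ψ M lam)ᶜ, Real.exp (-ψ t) * derivSum ψ M lam t ^ n ≤
      ErrPsi ψ M lam := by
    have h0 : 0 ≤ ∫ t in (ASet ψ M lam)ᶜ, Real.exp (-ψ t) :=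
      integral_nonneg fun t => (Real.exp_pos _).le
    have hsup : ∫ t in (ASet ψ M lam)ᶜ, Real.exp (-ψ t) * derivSum ψ M lam t ^ n ≤
        ⨆ k ∈ Finset.Icc 1 M,
          ∫ t in (ASet ψ M lam)ᶜ, Real.exp (-ψ t) * derivSum ψ M lam t ^ k := by
      have hmem : n ∈ Finset.Icc 1 M := Finset.mem_Icc.2 ⟨hn, hnM⟩
      refine le_ciSup_of_le ?_ n (by rw [ciSup_pos hmem])
      refine ((((Finset.Icc 1 M).finite_toSet.image fun k =>
        ∫ t in (ASet ψ M lam)ᶜ, Real.exp (-ψ t) * derivSum ψ M lam t ^ k).insert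
          0).subset ?_).bddAbove
      rintro _ ⟨k, rfl⟩
      by_cases hk : k ∈ Finset.Icc 1 M
      · exact Or.inr ⟨k, hk, by simp only [ciSup_pos hk]⟩
      · exact Or.inl (by simp [hk])
    unfold ErrPsi
    linarith
  calc ∫ t in (ASet ψ M lam)ᶜ, |iteratedDeriv n (fun s => Real.exp (-ψ s)) t|
      ≤ ∫ t in (ASet ψ M lam)ᶜ, (Nat.factorial n : ℝ) * lam ^ n *
          (Real.exp (-ψ t) * derivSum ψ M lam t ^ n) := by
        refine setIntegral_mono_on (hψ.integrable_iteratedDeriv_exp_neg n).abs.integrableOn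
          (hpow.const_mul _).integrableOn hmeas fun t ht => ?_
        have ht' : 1 ≤ derivSum ψ M lam t :=
          (lt_of_not_ge (show ¬ derivSum ψ M lam t ≤ 1 from ht)).le
        have h := abs_iteratedDeriv_exp_neg_le hψ.smooth hlam M t n hnM
        rw [max_eq_right ht'] at h
        linarith
    _ = (Nat.factorial n : ℝ) * lam ^ n *
          ∫ t in (ASet ψ M lam)ᶜ, Real.exp (-ψ t) * derivSum ψ M lam t ^ n :=
        integral_const_mul _ _
    _ ≤ _ := by gcongr

end Assumption2

lemma iteratedDeriv_locDensity {ψ : ℝ → ℝ} (hψ : ContDiff ℝ (⊤ : ℕ∞) ψ) (τ y x : ℝ) (n : ℕ) :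
    iteratedDeriv n (fun t => locDensity ψ τ y t) x =
      (1 / τ) * ((-1) ^ n * ((τ⁻¹) ^ n *
        iteratedDeriv n (fun s => Real.exp (-ψ s)) ((y - x) / τ))) := by
  have hn : ((n : ℕ∞) : WithTop ℕ∞) ≤ ((⊤ : ℕ∞) : WithTop ℕ∞) := by exact_mod_cast le_top
  have hscale := iteratedDeriv_comp_const_mul ((contDiff_exp_neg hψ).of_le hn) τ⁻¹
  have hshift := iteratedDeriv_comp_const_sub n (fun u => Real.exp (-ψ (τ⁻¹ * u))) y
  unfold locDensity
  simp only [div_eq_inv_mul _ τ, mul_one] at *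
  rw [iteratedDeriv_const_mul_field, hshift, hscale]
  simp

lemma setIntegral_comp_sub_div (g : ℝ → ℝ) {s : Set ℝ} (hs : MeasurableSet s) (x τ : ℝ) :
    ∫ y in {y : ℝ | (y - x) / τ ∈ s}, g ((y - x) / τ) = |τ| * ∫ t in s, g t := by
  have hmeas : MeasurableSet {y : ℝ | (y - x) / τ ∈ s} :=
    (show Measurable fun y : ℝ => (y - x) / τ by fun_prop) hs
  rw [← integral_indicator hmeas, ← integral_indicator hs, ← smul_eq_mul,
    ← Measure.integral_comp_div (s.indicator g) τ,
    ← integral_sub_right_eq_self (fun y => s.indicator g (y / τ)) x]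
  rfl

/-- Lemma 5(ii): (i) each derivative of `ρ = e^{−ψ}` of order
`1 ≤ n ≤ 2N` is integrable with zero integral; (ii) the derivatives of the
location density integrate to at most `(n!·λ^n·e^n/τ^n)·Err(ψ,2N,λ)` over the
complement region. -/
theorem location_derivative_integral_bounds
    (σ τ lam : ℝ) (ψ : ℝ → ℝ) (Cψ : ℕ) (Ct : ℝ) (N : ℕ)
    (hψ : Assumption2 ψ Cψ Ct)
    (hN : 1 ≤ N) (hτ : 0 < τ) (hlam : 0 < lam) :
    (∀ n : ℕ, 1 ≤ n → n ≤ 2*N →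
      Integrable (iteratedDeriv n (fun t : ℝ => Real.exp (-ψ t))) ∧
      ∫ t : ℝ, iteratedDeriv n (fun s : ℝ => Real.exp (-ψ s)) t = 0) ∧
    (∀ n : ℕ, 1 ≤ n → n ≤ 2*N → ∀ x : ℝ,
      ∫ y in {y : ℝ | (y - x)/τ ∈ (ASet ψ (2*N) lam)ᶜ},
          |iteratedDeriv n (fun t => locDensity ψ τ y t) x|
        ≤ ((Nat.factorial n : ℝ) * lam^n * (Real.exp 1)^n / τ^n) *
            ErrPsi ψ (2*N) lam) := by
  refine ⟨fun n hn _ => ⟨hψ.integrable_iteratedDeriv_exp_neg n,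
    hψ.integral_iteratedDeriv_exp_neg hn⟩, fun n hn hnN x => ?_⟩
  have hmeas := (measurableSet_ASet hψ.smooth (2 * N) lam).compl
  have hbound := hψ.setIntegral_abs_iteratedDeriv_exp_neg_le hlam hn hnN
  have habs : ∀ y, |iteratedDeriv n (fun t => locDensity ψ τ y t) x| =
      (1 / τ * (τ⁻¹) ^ n) *
        |iteratedDeriv n (fun s => Real.exp (-ψ s)) ((y - x) / τ)| := by
    intro y
    rw [iteratedDeriv_locDensity hψ.smooth, abs_mul, abs_mul, abs_mul, abs_pow (-1), abs_neg,
      abs_one, one_pow, abs_of_nonneg (by positivity : (0 : ℝ) ≤ 1 / τ),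
      abs_of_nonneg (by positivity : (0 : ℝ) ≤ (τ⁻¹) ^ n)]
    ring
  simp only [habs]
  rw [integral_const_mul,
    setIntegral_comp_sub_div (fun t => |iteratedDeriv n (fun s => Real.exp (-ψ s)) t|) hmeas,
    abs_of_pos hτ]
  have hrhs : 0 ≤ (Nat.factorial n : ℝ) * lam ^ n * ErrPsi ψ (2 * N) lam :=
    (integral_nonneg fun _ => abs_nonneg _).trans hbound
  have hexp : 1 ≤ Real.exp 1 ^ n := one_le_pow₀ (Real.one_le_exp zero_le_one)
  set I := ∫ t in (ASet ψ (2 * N) lam)ᶜ, |iteratedDeriv n (fun s => Real.exp (-ψ s)) t|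
  calc 1 / τ * τ⁻¹ ^ n * (τ * I) = (τ⁻¹) ^ n * I := by field_simp
    _ ≤ (τ⁻¹) ^ n * ((Nat.factorial n : ℝ) * lam ^ n * ErrPsi ψ (2 * N) lam *
          Real.exp 1 ^ n) := by
        gcongr
        exact hbound.trans (le_mul_of_one_le_right hrhs hexp)
    _ = _ := by rw [inv_pow]; field_simp
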